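/- arXiv:0705.3137 — 2 statements merged into one kernel-verified Lean document; each statement's English description precedes it below -/
import Mathlib

section
/- Let α = (α0,α1,α2,α3,α4,α5,α6) ∈ ℂ^7 satisfy 3α0+α1+2α2+α3+2α4+2α5+α6 = 0, and let q,p : ℝ → ℂ be differentiable with q(t) ≠ 0 for all t, satisfying q'(t) = ∂I/∂p(q(t),p(t);α) and p'(t) = −∂I/∂q(q(t),p(t);α) for all t. Define q̃(t) = 1/q(−t), p̃(t) = −(q(−t)·p(−t) + α0)·q(−t), and α̃ = (α0, α6, α5, α3, α4, α2, α1). Then q̃'(t) = ∂I/∂p(q̃(t),p̃(t);α̃) and p̃'(t) = −∂I/∂q(q̃(t),p̃(t);α̃) for all t; that is, π2 is a Bäcklund transformation of the system. -/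
/-- The polynomial Hamiltonian `I(q,p;α)` of the second-order polynomial
Hamiltonian system with extended affine Weyl group symmetry of type `E₆⁽¹⁾`. -/
noncomputable def hamI (a0 a1 a2 a3 a4 a5 a6 q p : ℂ) : ℂ :=
  (q - 1)^2 * q^2 * p^3
  - q * (q - 1) * ((a1 + 2*a2 + a3 + 2*a4) * q - a1 - 2*a2) * p^2
  + ((-3*a0^2 - 2*a0*(a1 + 2*a2 + a3 + 2*a4) - 3*a0*a5
      - a5*(a1 + 2*a2 + a3 + 2*a4 + a5)) * q^2
     + (-3*a0^2 - a2^2 + 2*a0*(a1 + 2*a2 + a3 + 2*a4) + 3*a0*a5 + 2*a2*a5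
        + a1*(a5 - a2) + (a4 + a5)*(a3 + a4 + a5)) * q
     + a2*(a1 + a2)) * p
  + a0*(a0 + a5)*(a0 + a5 + a6) * q

/-- The partial derivative `∂I/∂p`. -/
noncomputable def hamIp (a0 a1 a2 a3 a4 a5 a6 q p : ℂ) : ℂ :=
  deriv (fun x => hamI a0 a1 a2 a3 a4 a5 a6 q x) p

/-- The partial derivative `∂I/∂q`. -/
noncomputable def hamIq (a0 a1 a2 a3 a4 a5 a6 q p : ℂ) : ℂ :=
  deriv (fun x => hamI a0 a1 a2 a3 a4 a5 a6 x p) q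

lemma cubic_deriv (A B C D x : ℂ) :
    HasDerivAt (fun x : ℂ => A * x^3 + B * x^2 + C * x + D) (3*A*x^2 + 2*B*x + C) x := by
  have h1 := (hasDerivAt_pow 3 x).const_mul A
  have h2 := (hasDerivAt_pow 2 x).const_mul B
  have h3 := (hasDerivAt_id x).const_mul C
  have h := ((h1.add h2).add h3).add_const D
  refine (h.congr_deriv ?_)
  norm_num
  ring

lemma quartic_deriv (E A B C D x : ℂ) :
    HasDerivAt (fun x : ℂ => E * x^4 + (A * x^3 + B * x^2 + C * x + D))
      (4*E*x^3 + (3*A*x^2 + 2*B*x + C)) x := by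
  have h1 := (hasDerivAt_pow 4 x).const_mul E
  refine ((h1.add (cubic_deriv A B C D x)).congr_deriv ?_)
  norm_num
  ring

lemma hamIp_eq (a0 a1 a2 a3 a4 a5 a6 q p : ℂ) :
    hamIp a0 a1 a2 a3 a4 a5 a6 q p =
      3 * ((q - 1)^2 * q^2) * p^2
      + 2 * (- q * (q - 1) * ((a1 + 2*a2 + a3 + 2*a4) * q - a1 - 2*a2)) * p
      + (((-3*a0^2 - 2*a0*(a1 + 2*a2 + a3 + 2*a4) - 3*a0*a5 - a5*(a1 + 2*a2 + a3 + 2*a4 + a5)) * q^2 + (-3*a0^2 - a2^2 + 2*a0*(a1 + 2*a2 + a3 + 2*a4) + 3*a0*a5 + 2*a2*a5 + a1*(a5 - a2) + (a4 + a5)*(a3 + a4 + a5)) * q) + a2*(a1 + a2)) := by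
  unfold hamIp
  rw [← (cubic_deriv _ _ _ (a0*(a0 + a5)*(a0 + a5 + a6) * q) p).deriv]
  congr 1
  funext x
  unfold hamI
  ring

lemma hamIq_eq (a0 a1 a2 a3 a4 a5 a6 q p : ℂ) :
    hamIq a0 a1 a2 a3 a4 a5 a6 q p =
      4 * p^3 * q^3 + (3 * (-2 * p^3 - (a1 + 2*a2 + a3 + 2*a4) * p^2) * q^2
      + 2 * (p^3 + (2*a1 + 4*a2 + a3 + 2*a4) * p^2
        + (-3*a0^2 - 2*a0*(a1 + 2*a2 + a3 + 2*a4) - 3*a0*a5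
          - a5*(a1 + 2*a2 + a3 + 2*a4 + a5)) * p) * q
      + (-(a1 + 2*a2) * p^2
        + (-3*a0^2 - a2^2 + 2*a0*(a1 + 2*a2 + a3 + 2*a4) + 3*a0*a5 + 2*a2*a5
          + a1*(a5 - a2) + (a4 + a5)*(a3 + a4 + a5)) * p
        + a0*(a0 + a5)*(a0 + a5 + a6))) := by
  unfold hamIq
  rw [← (quartic_deriv (p^3) _ _ _ (a2*(a1 + a2) * p) q).deriv]
  congr 1
  funext x
  unfold hamI
  ring

/-- `π₂ : (q,p,t;α) ↦ (1/q, -(qp+α₀)q, -t; α₀, α₆, α₅, α₃, α₄, α₂, α₁)`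
is a Bäcklund transformation of the Hamiltonian system for `I`. -/
theorem statement6 (a0 a1 a2 a3 a4 a5 a6 : ℂ)
    (hα : 3*a0 + a1 + 2*a2 + a3 + 2*a4 + 2*a5 + a6 = 0)
    (q p : ℝ → ℂ) (hq0 : ∀ t : ℝ, q t ≠ 0)
    (hq : ∀ t : ℝ, HasDerivAt q (hamIp a0 a1 a2 a3 a4 a5 a6 (q t) (p t)) t)
    (hp : ∀ t : ℝ, HasDerivAt p (-(hamIq a0 a1 a2 a3 a4 a5 a6 (q t) (p t))) t) :
    ∀ t : ℝ,
      HasDerivAt (fun s : ℝ => 1 / q (-s))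
        (hamIp a0 a6 a5 a3 a4 a2 a1
          (1 / q (-t)) (-(q (-t) * p (-t) + a0) * q (-t))) t ∧
      HasDerivAt (fun s : ℝ => -(q (-s) * p (-s) + a0) * q (-s))
        (-(hamIq a0 a6 a5 a3 a4 a2 a1
          (1 / q (-t)) (-(q (-t) * p (-t) + a0) * q (-t)))) t := by
  have h6 : a6 = -(3*a0 + a1 + 2*a2 + a3 + 2*a4 + 2*a5) := by linear_combination hα
  intro t
  have hneg : HasDerivAt (fun s : ℝ => -s) (-1) t := by
    exact hasDerivAt_neg t
  have hQ : HasDerivAt (fun s : ℝ => q (-s))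
      (-(hamIp a0 a1 a2 a3 a4 a5 a6 (q (-t)) (p (-t)))) t := by
    have h := HasDerivAt.scomp t (hq (-t)) hneg
    simpa [Function.comp_def] using h
  have hP : HasDerivAt (fun s : ℝ => p (-s))
      (hamIq a0 a1 a2 a3 a4 a5 a6 (q (-t)) (p (-t))) t := by
    have h := HasDerivAt.scomp t (hp (-t)) hneg
    simpa [Function.comp_def] using h
  have h0 := hq0 (-t)
  constructor
  · have h := hQ.inv h0
    simp only [one_div]
    refine h.congr_deriv ?_
    rw [hamIp_eq, hamIp_eq]
    generalize q (-t) = x at *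
    generalize p (-t) = y at *
    subst h6
    field_simp
    ring
  · have h := (((hQ.mul hP).add_const a0).neg).mul hQ
    refine h.congr_deriv ?_
    simp only [Pi.neg_apply, Pi.mul_apply]
    rw [hamIp_eq, hamIq_eq, hamIq_eq]
    generalize q (-t) = x at *
    generalize p (-t) = y at *
    subst h6
    field_simp
    ring
end

section
/- Let α = (α0,α1,α2,α3,α4) ∈ ℂ^5 satisfy α0+α1+2α2+α3+α4 = 1, let J ⊆ ℝ∖{0,1} be an open interval, and let q,p : J → ℂ be differentiable with q(t) ≠ 0 for all t ∈ J, satisfying q'(t) = ∂G/∂p(q(t),p(t),t;α) and p'(t) = −∂G/∂q(q(t),p(t),t;α). Define q̃(t) = q(t), p̃(t) = p(t) − α4/q(t), and α̃ = (α0, α1, α2+α4, α3, −α4). Then q̃'(t) = ∂G/∂p(q̃(t),p̃(t),t;α̃) and p̃'(t) = −∂G/∂q(q̃(t),p̃(t),t;α̃) for all t ∈ J; that is, w4 is a Bäcklund transformation of the G-system. -/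
/-- The polynomial Hamiltonian `G(q,p,t;α)` equivalent to the Painlevé VI
Hamiltonian, characterized by holomorphy conditions. -/
noncomputable def hamG (a0 a1 a2 a3 a4 q p t : ℂ) : ℂ :=
  -(q^3 * p^4) / (t * (t - 1))
  - (a0 + a3 - 2*a4 - 1) * q^2 * p^3 / (t * (t - 1))
  - (t + 1) * q^2 * p^2 / (t * (t - 1))
  - (a1*a2 + a2^2 + 2*a4 - 2*a0*a4 - 2*a3*a4 + a4^2) * q * p^2 / (t * (t - 1))
  - ((a3 - a4) * t + a0 - a4 - 1) * q * p / (t * (t - 1))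
  - q / (t - 1)
  + a4 * (a2 + a4) * (a1 + a2 + a4) * p / (t * (t - 1))

/-- The partial derivative `∂G/∂p`. -/
noncomputable def hamGp (a0 a1 a2 a3 a4 q p t : ℂ) : ℂ :=
  deriv (fun x => hamG a0 a1 a2 a3 a4 q x t) p

/-- The partial derivative `∂G/∂q`. -/
noncomputable def hamGq (a0 a1 a2 a3 a4 q p t : ℂ) : ℂ :=
  deriv (fun x => hamG a0 a1 a2 a3 a4 x p t) q

theorem hamGp_eq (a0 a1 a2 a3 a4 q p t : ℂ) : hamGp a0 a1 a2 a3 a4 q p t =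
    (-(q^3 * (4 * p^3)) - (a0 + a3 - 2*a4 - 1) * q^2 * (3 * p^2)
      - (t + 1) * q^2 * (2 * p)
      - (a1*a2 + a2^2 + 2*a4 - 2*a0*a4 - 2*a3*a4 + a4^2) * q * (2 * p)
      - ((a3 - a4) * t + a0 - a4 - 1) * q
      + a4 * (a2 + a4) * (a1 + a2 + a4)) / (t * (t - 1)) := by
  unfold hamGp hamG
  apply HasDerivAt.deriv
  have h1 := hasDerivAt_id' p
  have h2 := hasDerivAt_pow 2 p
  have h3 := hasDerivAt_pow 3 p
  have h4 := hasDerivAt_pow 4 p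
  have := ((((((((h4.const_mul (q^3)).fun_neg).div_const (t * (t - 1))).fun_sub
    ((h3.const_mul ((a0 + a3 - 2*a4 - 1) * q^2)).div_const (t * (t - 1)))).fun_sub
    ((h2.const_mul ((t + 1) * q^2)).div_const (t * (t - 1)))).fun_sub
    ((h2.const_mul ((a1*a2 + a2^2 + 2*a4 - 2*a0*a4 - 2*a3*a4 + a4^2) * q)).div_const
      (t * (t - 1)))).fun_sub
    ((h1.const_mul (((a3 - a4) * t + a0 - a4 - 1) * q)).div_const (t * (t - 1)))).sub_const
    (q / (t - 1))).fun_add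
    ((h1.const_mul (a4 * (a2 + a4) * (a1 + a2 + a4))).div_const (t * (t - 1)))
  refine this.congr_deriv ?_
  norm_num
  ring

theorem hamGq_eq (a0 a1 a2 a3 a4 q p t : ℂ) (ht : t ≠ 0) :
    hamGq a0 a1 a2 a3 a4 q p t =
    (-(3 * q^2 * p^4) - (a0 + a3 - 2*a4 - 1) * (2 * q) * p^3
      - (t + 1) * (2 * q) * p^2
      - (a1*a2 + a2^2 + 2*a4 - 2*a0*a4 - 2*a3*a4 + a4^2) * p^2
      - ((a3 - a4) * t + a0 - a4 - 1) * p - t) / (t * (t - 1)) := by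
  have e : (fun x => hamG a0 a1 a2 a3 a4 x p t) = fun x =>
      (-p^4 / (t * (t - 1))) * x^3
      + (-((a0 + a3 - 2*a4 - 1) * p^3 + (t + 1) * p^2) / (t * (t - 1))) * x^2
      + (-((a1*a2 + a2^2 + 2*a4 - 2*a0*a4 - 2*a3*a4 + a4^2) * p^2
        + ((a3 - a4) * t + a0 - a4 - 1) * p + t) / (t * (t - 1))) * x
      + a4 * (a2 + a4) * (a1 + a2 + a4) * p / (t * (t - 1)) := by
    funext x
    have : x / (t - 1) = x * t / (t * (t - 1)) := by
      rw [mul_comm x t, mul_div_mul_left _ _ ht]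
    unfold hamG
    rw [this]
    ring
  unfold hamGq
  rw [e]
  apply HasDerivAt.deriv
  have := ((((hasDerivAt_pow 3 q).const_mul (-p^4 / (t * (t - 1)))).fun_add
    ((hasDerivAt_pow 2 q).const_mul
      (-((a0 + a3 - 2*a4 - 1) * p^3 + (t + 1) * p^2) / (t * (t - 1))))).fun_add
    ((hasDerivAt_id' q).const_mul
      (-((a1*a2 + a2^2 + 2*a4 - 2*a0*a4 - 2*a3*a4 + a4^2) * p^2
        + ((a3 - a4) * t + a0 - a4 - 1) * p + t) / (t * (t - 1))))).add_const
      (a4 * (a2 + a4) * (a1 + a2 + a4) * p / (t * (t - 1)))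
  refine this.congr_deriv ?_
  norm_num
  ring

/-- `w₄ : (q,p;α) ↦ (q, p - α₄/q; α₀, α₁, α₂+α₄, α₃, -α₄)`
is a Bäcklund transformation of the `G`-system. -/
theorem statement16 (a0 a1 a2 a3 a4 : ℂ)
    (hα : a0 + a1 + 2*a2 + a3 + a4 = 1)
    (aa bb : ℝ) (hJ : Set.Ioo aa bb ⊆ {t : ℝ | t ≠ 0 ∧ t ≠ 1})
    (q p : ℝ → ℂ) (hq0 : ∀ t ∈ Set.Ioo aa bb, q t ≠ 0)
    (hq : ∀ t ∈ Set.Ioo aa bb,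
      HasDerivAt q (hamGp a0 a1 a2 a3 a4 (q t) (p t) (t : ℂ)) t)
    (hp : ∀ t ∈ Set.Ioo aa bb,
      HasDerivAt p (-(hamGq a0 a1 a2 a3 a4 (q t) (p t) (t : ℂ))) t) :
    ∀ t ∈ Set.Ioo aa bb,
      HasDerivAt q
        (hamGp a0 a1 (a2 + a4) a3 (-a4)
          (q t) (p t - a4 / q t) (t : ℂ)) t ∧
      HasDerivAt (fun s : ℝ => p s - a4 / q s)
        (-(hamGq a0 a1 (a2 + a4) a3 (-a4)
          (q t) (p t - a4 / q t) (t : ℂ))) t := by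
  intro t ht
  have ht0 : (t : ℂ) ≠ 0 := by exact_mod_cast (hJ ht).1
  have ht1 : (t : ℂ) - 1 ≠ 0 := sub_ne_zero.mpr (by exact_mod_cast (hJ ht).2)
  have hQ := hq0 t ht
  have h1 := hq t ht
  have h2 := hp t ht
  have ha : a0 = 1 - a1 - 2*a2 - a3 - a4 := by linear_combination hα
  subst ha
  constructor
  · refine h1.congr_deriv ?_
    rw [hamGp_eq, hamGp_eq]
    field_simp
    ring
  · have h3 := h2.fun_sub ((hasDerivAt_const t a4).fun_div h1 hQ)
    refine h3.congr_deriv ?_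
    rw [hamGp_eq, hamGq_eq _ _ _ _ _ _ _ _ ht0, hamGq_eq _ _ _ _ _ _ _ _ ht0]
    field_simp
    ring
end
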